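/- arXiv:2012.10579 — 2 statements merged into one kernel-verified Lean document; each statement's English description precedes it below -/
import Mathlib

section
/- Fix τ ∈ (0,1), λ > 0, covariates x_1, ..., x_n ∈ ℝ^p, and a symmetric positive semidefinite kernel matrix Σ ∈ ℝ^{m×m}. For data Y ∈ ℝ^{n×m}, let (μ(Y), b(Y)) ∈ ℝ^p × (ℝ^m)^p be the minimizer of G(μ, b; Y) = Σ_{i=1}^n Σ_{j=1}^m ρ_τ(Y_{ij} − x_iᵀμ − Σ_{k=1}^p x_{ik}(Σ b_k)_j) + (λ/2) Σ_{k=1}^p b_kᵀ Σ b_k, and let the fitted values be Ŷ_{ij}(Y) = x_iᵀμ(Y) + Σ_{k=1}^p x_{ik}(Σ b_k(Y))_j. Let Se(Y) = {(i,j) : Ŷ_{ij}(Y) = Y_{ij}} be the set of interpolated observations. Suppose that at the given Y the fitted-value map Y ↦ (Ŷ_{ij}(Y)) is well defined and differentiable, and that there is a neighborhood U of Y such that for all Y' ∈ U and all (i,j): (i,j) ∈ Se(Y') if and only if (i,j) ∈ Se(Y), and for (i,j) ∉ Se(Y) the value Ŷ_{ij}(Y') does not depend on the coordinate Y'_{ij}.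 Then the divergence div(Ŷ) = Σ_{i=1}^n Σ_{j=1}^m ∂Ŷ_{ij}/∂Y_{ij} evaluated at Y equals |Se(Y)|, the number of interpolated observations. -/
open Matrix
open scoped BigOperators

/-- The check (pinball) loss function of quantile regression:
`ρ_τ(r) = τ r` if `r > 0` and `−(1−τ) r` if `r ≤ 0`. -/
noncomputable def checkFn (τ r : ℝ) : ℝ := if 0 < r then τ * r else -(1 - τ) * r

/-- The penalized quantile-regression objective
`G(μ, b; Y) = ∑_{i,j} ρ_τ(Y_{ij} − x_iᵀμ − ∑_k x_{ik}(Σ b_k)_j) + (λ/2) ∑_k b_kᵀ Σ b_k`. -/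
noncomputable def sqrObjective {n m p : ℕ} (τ lam : ℝ)
    (x : Fin n → Fin p → ℝ) (Sig : Matrix (Fin m) (Fin m) ℝ)
    (Y : Fin n → Fin m → ℝ) (μ : Fin p → ℝ) (b : Fin p → Fin m → ℝ) : ℝ :=
  (∑ i, ∑ j, checkFn τ
      (Y i j - (∑ k, x i k * μ k) - ∑ k, x i k * Sig.mulVec (b k) j)) +
    lam / 2 * ∑ k, (b k ⬝ᵥ Sig.mulVec (b k))

open Topology in
/-- If the `(i, j)` entry of `F` along the line `t ↦ Y + t E` agrees with `g` as long as the line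
stays in a neighborhood of `Y`, then the derivative of `g` at `0` is the `(i, j)` entry of the
directional derivative of `F` at `Y` along `E`. -/
theorem fderiv_apply_apply_of_eq_on_line {ι κ : Type*} [Fintype ι] [Fintype κ]
    {F : (ι → κ → ℝ) → ι → κ → ℝ} {Y : ι → κ → ℝ} (hF : DifferentiableAt ℝ F Y)
    {U : Set (ι → κ → ℝ)} (hU : U ∈ 𝓝 Y) {E : ι → κ → ℝ} {i : ι} {j : κ}
    {g : ℝ → ℝ} {c : ℝ} (hg : HasDerivAt g c 0)
    (h : ∀ t : ℝ, Y + t • E ∈ U → F (Y + t • E) i j = g t) :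
    fderiv ℝ F Y E i j = c := by
  have hline : HasDerivAt (fun t : ℝ => Y + t • E) E 0 := by
    simpa using ((hasDerivAt_id (0 : ℝ)).smul_const E).const_add Y
  have hY : Y + (0 : ℝ) • E = Y := by simp
  have hcomp : HasDerivAt (fun t : ℝ => F (Y + t • E)) (fderiv ℝ F Y E) 0 :=
    HasFDerivAt.comp_hasDerivAt (0 : ℝ) (by rw [hY]; exact hF.hasFDerivAt) hline
  have hentry := hasDerivAt_pi.1 (hasDerivAt_pi.1 hcomp i) j
  have hmem : ∀ᶠ t : ℝ in 𝓝 0, Y + t • E ∈ U :=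
    hline.continuousAt.eventually_mem (by rwa [hY])
  exact hentry.unique (hg.congr_of_eventuallyEq (hmem.mono h))

/-- Theorem 1: divergence equals the number of interpolated points.
Fix `τ ∈ (0,1)`, `λ > 0`, covariates `x_i ∈ ℝ^p` and a symmetric PSD kernel matrix
`Σ`.  Let `(μ(Y), b(Y))` minimize the penalized quantile objective and let
`Ŷ_{ij}(Y) = x_iᵀμ(Y) + ∑_k x_{ik}(Σ b_k(Y))_j` be the fitted values, with
interpolation set `Se(Y) = {(i,j) : Ŷ_{ij}(Y) = Y_{ij}}`.  If the fitted-value map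
is differentiable at `Y`, and on a neighborhood `U` of `Y` the set `Se` is constant
and, off `Se`, `Ŷ_{ij}` does not depend on the coordinate `Y'_{ij}`, then the
divergence `∑_{i,j} ∂Ŷ_{ij}/∂Y_{ij}` at `Y` equals `|Se(Y)|`. -/
theorem divergence_eq_card_interpolated {n m p : ℕ}
    (τ lam : ℝ) (hτ : τ ∈ Set.Ioo (0:ℝ) 1) (hlam : 0 < lam)
    (x : Fin n → Fin p → ℝ)
    (Sig : Matrix (Fin m) (Fin m) ℝ) (hSymm : Sig.IsSymm) (hPSD : Sig.PosSemidef)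
    (μfit : (Fin n → Fin m → ℝ) → Fin p → ℝ)
    (bfit : (Fin n → Fin m → ℝ) → Fin p → Fin m → ℝ)
    (hmin : ∀ (Y : Fin n → Fin m → ℝ) (μ' : Fin p → ℝ) (b' : Fin p → Fin m → ℝ),
      sqrObjective τ lam x Sig Y (μfit Y) (bfit Y) ≤ sqrObjective τ lam x Sig Y μ' b')
    (Yhat : (Fin n → Fin m → ℝ) → Fin n → Fin m → ℝ)
    (hYhat : ∀ Y i j,
      Yhat Y i j = (∑ k, x i k * μfit Y k) + ∑ k, x i k * Sig.mulVec (bfit Y k) j)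
    (Y : Fin n → Fin m → ℝ)
    (hdiff : DifferentiableAt ℝ Yhat Y)
    (U : Set (Fin n → Fin m → ℝ)) (hU : U ∈ nhds Y)
    (hSe : ∀ Y' ∈ U, ∀ i j, (Yhat Y' i j = Y' i j ↔ Yhat Y i j = Y i j))
    (hindep : ∀ i j, Yhat Y i j ≠ Y i j →
      ∀ Y' ∈ U, ∀ Y'' ∈ U,
        (∀ i' j', (i', j') ≠ (i, j) → Y' i' j' = Y'' i' j') →
        Yhat Y' i j = Yhat Y'' i j) :
    (∑ i, ∑ j, fderiv ℝ Yhat Y (Pi.single i (Pi.single j (1:ℝ))) i j) =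
      (Nat.card {ij : Fin n × Fin m // Yhat Y ij.1 ij.2 = Y ij.1 ij.2} : ℝ) := by
  classical
  have hpartial : ∀ i j, fderiv ℝ Yhat Y (Pi.single i (Pi.single j (1 : ℝ))) i j =
      if Yhat Y i j = Y i j then 1 else 0 := by
    intro i j
    split_ifs with hij
    · refine fderiv_apply_apply_of_eq_on_line hdiff hU
        ((hasDerivAt_id (0 : ℝ)).const_add (Y i j)) fun t ht => ?_
      rw [(hSe _ ht i j).2 hij]
      simp
    · refine fderiv_apply_apply_of_eq_on_line hdiff hU
        (hasDerivAt_const (0 : ℝ) (Yhat Y i j)) fun t ht => ?_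
      refine hindep i j hij _ ht Y (mem_of_mem_nhds hU) fun i' j' hne => ?_
      rcases eq_or_ne i' i with rfl | hi
      · have hj : j' ≠ j := fun hj => hne (by rw [hj])
        simp [hj]
      · simp [hi]
  simp_rw [hpartial]
  rw [← Fintype.sum_prod_type' fun i j => if Yhat Y i j = Y i j then (1 : ℝ) else 0,
    Finset.sum_boole, Nat.card_eq_fintype_card, Fintype.card_subtype]
end

section
/- Fix τ ∈ (0,1). Let Y be an integrable real-valued random variable with cumulative distribution function F, and suppose q ∈ ℝ satisfies F(q) = τ. Then q minimizes the expected check loss: for every a ∈ ℝ, E[ρ_τ(Y − q)] ≤ E[ρ_τ(Y − a)]. That is, the τ-th quantile of Y minimizes a ↦ E[ρ_τ(Y − a)]. -/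
open MeasureTheory

theorem checkFn_eq_add_max (τ r : ℝ) : checkFn τ r = τ * r + max (-r) 0 := by
  unfold checkFn
  split_ifs with h
  · rw [max_eq_right (by linarith)]; ring
  · rw [max_eq_left (by linarith)]; ring

/-- The subgradient inequality for the check function, with subgradient `τ - 1{y ≤ q}`. -/
theorem checkFn_add_indicator_mul_le {τ : ℝ} (y q a : ℝ) :
    checkFn τ (y - q) + ((Set.Iic q).indicator 1 y - τ) * (a - q) ≤ checkFn τ (y - a) := by
  simp only [checkFn_eq_add_max]
  by_cases h : y ≤ q
  · rw [Set.indicator_of_mem (Set.mem_Iic.2 h), max_eq_left (by linarith : 0 ≤ -(y - q)),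
      Pi.one_apply]
    linarith [le_max_left (-(y - a)) 0]
  · rw [Set.indicator_of_notMem (by simpa using h), max_eq_right (by linarith : -(y - q) ≤ 0)]
    linarith [le_max_right (-(y - a)) 0]

theorem MeasureTheory.Integrable.checkFn_sub {Ω : Type*} [MeasurableSpace Ω] {μ : Measure Ω}
    [IsFiniteMeasure μ] {Y : Ω → ℝ} (hY : Integrable Y μ) (τ a : ℝ) :
    Integrable (fun ω => checkFn τ (Y ω - a)) μ := by
  have h : Integrable (fun ω => Y ω - a) μ := hY.sub (integrable_const a)
  simp only [checkFn_eq_add_max]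
  exact (h.const_mul τ).add h.neg.pos_part

/-- For `τ ∈ (0,1)` and an integrable real random variable `Y` with
CDF `F`, if `F(q) = τ` then `q` minimizes the expected check loss:
`E[ρ_τ(Y − q)] ≤ E[ρ_τ(Y − a)]` for every `a`. -/
theorem quantile_minimizes_expected_check_loss {Ω : Type*} [MeasureSpace Ω]
    [IsProbabilityMeasure (volume : Measure Ω)]
    (τ : ℝ) (hτ : τ ∈ Set.Ioo (0:ℝ) 1)
    (Y : Ω → ℝ) (hY : Integrable Y)
    (q : ℝ) (hq : (volume {ω | Y ω ≤ q}).toReal = τ) :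
    ∀ a : ℝ, (∫ ω, checkFn τ (Y ω - q)) ≤ ∫ ω, checkFn τ (Y ω - a) := by
  intro a
  have hs : NullMeasurableSet {ω | Y ω ≤ q} :=
    hY.aemeasurable.nullMeasurableSet_preimage measurableSet_Iic
  have heq : (fun ω => (Set.Iic q).indicator (1 : ℝ → ℝ) (Y ω)) =
      {ω | Y ω ≤ q}.indicator (fun _ => (1 : ℝ)) := rfl
  have hind : Integrable (fun ω => (Set.Iic q).indicator (1 : ℝ → ℝ) (Y ω)) := by
    rw [heq]
    exact (integrable_const (1 : ℝ)).indicator₀ hs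
  have hint : ∫ ω, (Set.Iic q).indicator (1 : ℝ → ℝ) (Y ω) = τ := by
    rw [heq, integral_indicator₀ hs, setIntegral_const, smul_eq_mul, mul_one]
    exact hq
  have hg : Integrable (fun ω => ((Set.Iic q).indicator (1 : ℝ → ℝ) (Y ω) - τ) * (a - q)) :=
    (hind.sub (integrable_const τ)).mul_const _
  have hzero : ∫ ω, ((Set.Iic q).indicator (1 : ℝ → ℝ) (Y ω) - τ) * (a - q) = 0 := by
    rw [integral_mul_const, integral_sub hind (integrable_const τ), hint]
    simp
  calc ∫ ω, checkFn τ (Y ω - q)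
      = ∫ ω, (checkFn τ (Y ω - q)
          + ((Set.Iic q).indicator (1 : ℝ → ℝ) (Y ω) - τ) * (a - q)) := by
        rw [integral_add (hY.checkFn_sub τ q) hg, hzero, add_zero]
    _ ≤ ∫ ω, checkFn τ (Y ω - a) :=
        integral_mono ((hY.checkFn_sub τ q).add hg) (hY.checkFn_sub τ a)
          fun ω => checkFn_add_indicator_mul_le (Y ω) q a
end
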